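/- Let P be an asymmetric n-Vee, K a field, and let A = ⊕_{i∈𝒜} A_i and C = ⊕_{j∈ℬ} C_j be finite direct sums of convex representations of P. (i) If there is a morphism of representations f : A → C all of whose components f_p are injective, then for every d ∈ P the number of indices i ∈ 𝒜 such that d is a maximal element of Supp(A_i) is at most the number of indices j ∈ ℬ such that d is a maximal element of Supp(C_j). (ii) If there is a morphism of representations g : A → C all of whose components g_p are surjective, then for every b ∈ P the number of indices j ∈ ℬ such that b is the minimal element of Supp(C_j) is at most the number of indices i ∈ 𝒜 such that b is the minimal element of Supp(A_i). -/

import Mathlib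

namespace GPM

/-- A subset `S` is connected if any two of its elements can be joined by a finite
sequence of elements of `S` in which consecutive elements are comparable. -/
def ConnectedIn {Q : Type*} [Preorder Q] (S : Set Q) : Prop :=
  ∀ x ∈ S, ∀ y ∈ S,
    Relation.ReflTransGen (fun a b => a ∈ S ∧ b ∈ S ∧ (a ≤ b ∨ b ≤ a)) x y

/-- `P` is an n-Vee with (unique) minimal element `m`: `m` is the unique minimal element,
the interval `[m, M]` is totally ordered for every maximal element `M`, and
`[m, M] ∩ [m, M'] = {m}` for distinct maximal elements `M, M'`. -/
structure IsNVee (P : Type*) [PartialOrder P] (m : P) : Prop where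
  isMin : IsMin m
  eq_of_isMin : ∀ p : P, IsMin p → p = m
  icc_chain : ∀ M : P, IsMax M → ∀ x ∈ Set.Icc m M, ∀ y ∈ Set.Icc m M, x ≤ y ∨ y ≤ x
  icc_inter : ∀ M M' : P, IsMax M → IsMax M' → M ≠ M' →
      Set.Icc m M ∩ Set.Icc m M' = {m}

/-- An asymmetric n-Vee: one of the legs is strictly longer than all the others. -/
structure IsAsymNVee (P : Type*) [PartialOrder P] (m : P) extends IsNVee P m : Prop where
  asym : ∃ M₀ : P, IsMax M₀ ∧ ∀ M : P, IsMax M → M ≠ M₀ →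
      Nat.card (Set.Icc m M) < Nat.card (Set.Icc m M₀)

/-- A representation of a poset `P` with values in `K`-vector spaces. -/
structure Rep (P : Type*) [Preorder P] (K : Type*) [Field K] where
  V : P → Type*
  [addCommGroup : ∀ p, AddCommGroup (V p)]
  [module : ∀ p, Module K (V p)]
  map : ∀ {p q : P}, p ≤ q → V p →ₗ[K] V q
  map_refl : ∀ p : P, map (le_refl p) = LinearMap.id
  map_comp : ∀ {p q r : P} (hpq : p ≤ q) (hqr : q ≤ r),
      (map hqr).comp (map hpq) = map (hpq.trans hqr)

attribute [instance] Rep.addCommGroup Rep.module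

/-- A morphism of representations (a natural transformation). -/
structure RepHom {P : Type*} [Preorder P] {K : Type*} [Field K] (M N : Rep P K) where
  app : ∀ p, M.V p →ₗ[K] N.V p
  natural : ∀ {p q : P} (h : p ≤ q), (N.map h).comp (app p) = (app q).comp (M.map h)

/-- The submodule of `K` underlying the convex representation of `S` at the point `p`:
all of `K` on `S`, and `0` off `S`. -/
noncomputable def convexSub (K : Type*) [Field K] {Q : Type*} (S : Set Q) (p : Q) :
    Submodule K K :=
  @ite _ (p ∈ S) (Classical.dec _) ⊤ ⊥

theorem convexSub_pos (K : Type*) [Field K] {Q : Type*} {S : Set Q} {p : Q} (h : p ∈ S) :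
    convexSub K S p = ⊤ := by
  rw [convexSub, if_pos h]

theorem convexSub_neg (K : Type*) [Field K] {Q : Type*} {S : Set Q} {p : Q} (h : p ∉ S) :
    convexSub K S p = ⊥ := by
  rw [convexSub, if_neg h]

/-- The canonical map between the fibers of the convex representations of `S` and `T`:
the identity of `K` when both fibers are `K`, and zero otherwise. -/
noncomputable def phiMap (K : Type*) [Field K] {Q : Type*} (S T : Set Q) (p q : Q) :
    ↥(convexSub K S p) →ₗ[K] ↥(convexSub K T q) :=
  @dite _ (p ∈ S ∧ q ∈ T) (Classical.dec _)
    (fun h => Submodule.inclusion (le_of_eq (by rw [convexSub_pos K h.1, convexSub_pos K h.2])))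
    (fun _ => 0)

theorem phiMap_neg (K : Type*) [Field K] {Q : Type*} {S T : Set Q} {p q : Q}
    (h : ¬(p ∈ S ∧ q ∈ T)) : phiMap K S T p q = 0 := by
  rw [phiMap, dif_neg h]

/-- The convex representation with support the interval-convex set `S`:
`K` at points of `S`, `0` elsewhere, with identity structure maps inside `S`. -/
noncomputable def convexRep (K : Type*) [Field K] {Q : Type*} [Preorder Q]
    (S : Set Q) (hS : S.OrdConnected) : Rep Q K where
  V p := ↥(convexSub K S p)
  map {p q} _ := phiMap K S S p q
  map_refl p := by
    show phiMap K S S p p = LinearMap.id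
    by_cases hp : p ∈ S
    · rw [phiMap, dif_pos ⟨hp, hp⟩]
      rfl
    · rw [phiMap_neg (K := K) (by tauto)]
      apply LinearMap.ext
      intro x
      have hx : x = 0 := by
        apply Subtype.ext
        have hle : convexSub K S p ≤ ⊥ := le_of_eq (convexSub_neg K hp)
        simpa using hle x.2
      simp [hx]
  map_comp {p q r} hpq hqr := by
    show (phiMap K S S q r).comp (phiMap K S S p q) = phiMap K S S p r
    by_cases hp : p ∈ S
    · by_cases hr : r ∈ S
      · have hq : q ∈ S := hS.out hp hr ⟨hpq, hqr⟩
        rw [phiMap, phiMap, phiMap, dif_pos ⟨hq, hr⟩, dif_pos ⟨hp, hq⟩, dif_pos ⟨hp, hr⟩]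
        rfl
      · rw [phiMap_neg (K := K) (S := S) (T := S) (p := q) (q := r) (by tauto),
          phiMap_neg (K := K) (S := S) (T := S) (p := p) (q := r) (by tauto)]
        simp
    · rw [phiMap_neg (K := K) (S := S) (T := S) (p := p) (q := q) (by tauto),
        phiMap_neg (K := K) (S := S) (T := S) (p := p) (q := r) (by tauto)]
      simp

/-- Direct sum of a (finite) family of representations. -/
def Rep.dfsum {P : Type*} [Preorder P] {K : Type*} [Field K]
    {ι : Type*} (X : ι → Rep P K) : Rep P K where
  V p := ∀ i, (X i).V p
  map h := LinearMap.pi fun i => ((X i).map h).comp (LinearMap.proj i)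
  map_refl p := by
    apply LinearMap.ext
    intro x
    funext i
    simp [(X i).map_refl]
  map_comp h1 h2 := by
    apply LinearMap.ext
    intro x
    funext i
    have := congrArg (fun f => f (x i)) ((X i).map_comp h1 h2)
    simp only [LinearMap.comp_apply] at this
    simpa using this

theorem phiMap_coe (K : Type*) [Field K] {Q : Type*} {S T : Set Q} {p q : Q}
    (hp : p ∈ S) (hq : q ∈ T) (x : convexSub K S p) : (phiMap K S T p q x : K) = x := by
  rw [phiMap, dif_pos ⟨hp, hq⟩]
  rfl

theorem convexSub_coe_eq_zero {K : Type*} [Field K] {Q : Type*} {S : Set Q} {p : Q}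
    (h : p ∉ S) (x : convexSub K S p) : (x : K) = 0 := by
  have hx : (x : K) ∈ (⊥ : Submodule K K) := convexSub_neg K h ▸ x.2
  simpa using hx

section Fiber

variable {K : Type*} [Field K] {Q : Type*} {ι κ : Type*}

open Classical in
/-- Extension by zero of a vector indexed by the summands satisfying `φ` to the fiber at `p` of
a direct sum of convex representations, all of the selected supports containing `p`. -/
noncomputable def fiberExtend (S : ι → Set Q) (p : Q) (φ : ι → Prop) (hφ : ∀ i, φ i → p ∈ S i) :
    ({i // φ i} → K) →ₗ[K] ∀ i, convexSub K (S i) p where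
  toFun x i := ⟨if h : φ i then x ⟨i, h⟩ else 0, by
    split_ifs with h
    · simp [convexSub_pos K (hφ i h)]
    · exact zero_mem _⟩
  map_add' x y := by
    funext i
    apply Subtype.ext
    by_cases h : φ i <;> simp [h]
  map_smul' c x := by
    funext i
    apply Subtype.ext
    by_cases h : φ i <;> simp [h]

theorem fiberExtend_coe_pos {S : ι → Set Q} {p : Q} {φ : ι → Prop}
    (hφ : ∀ i, φ i → p ∈ S i) (x : {i // φ i} → K) {i : ι} (h : φ i) :
    (fiberExtend S p φ hφ x i : K) = x ⟨i, h⟩ := by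
  simp [fiberExtend, h]

theorem fiberExtend_coe_neg {S : ι → Set Q} {p : Q} {φ : ι → Prop}
    (hφ : ∀ i, φ i → p ∈ S i) (x : {i // φ i} → K) {i : ι} (h : ¬φ i) :
    (fiberExtend S p φ hφ x i : K) = 0 := by
  simp [fiberExtend, h]

/-- The coordinates, at the summands satisfying `ψ`, of a vector in the fiber at `p` of a direct
sum of convex representations. -/
noncomputable def fiberRestrict (T : κ → Set Q) (p : Q) (ψ : κ → Prop) :
    (∀ j, convexSub K (T j) p) →ₗ[K] ({j // ψ j} → K) :=
  LinearMap.pi fun j => (convexSub K (T j.1) p).subtype.comp (LinearMap.proj j.1)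

theorem fiberRestrict_apply {T : κ → Set Q} {p : Q} {ψ : κ → Prop}
    (y : ∀ j, convexSub K (T j) p) (j : {j // ψ j}) :
    fiberRestrict T p ψ y j = y j.1 :=
  rfl

end Fiber

section Counting

variable {Q : Type*} [PartialOrder Q] {K : Type*} [Field K] {ι κ : Type*}
  {S : ι → Set Q} {T : κ → Set Q}
  {hS : ∀ i, (S i).OrdConnected} {hT : ∀ j, (T j).OrdConnected}

theorem RepHom.naturality_apply {M N : Rep Q K} (f : RepHom M N) {p q : Q} (h : p ≤ q)
    (x : M.V p) : N.map h (f.app p x) = f.app q (M.map h x) :=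
  LinearMap.congr_fun (f.natural h) x

theorem dfsum_map_coe (S : ι → Set Q) (hS : ∀ i, (S i).OrdConnected) {p q : Q} (h : p ≤ q)
    (x : ∀ i, convexSub K (S i) p) (i : ι) :
    ((show ∀ i, convexSub K (S i) q from
      (Rep.dfsum fun i => convexRep K (S i) (hS i)).map h x) i : K) =
      (phiMap K (S i) (S i) p q (x i) : K) :=
  rfl

/-- A monomorphism between finite direct sums of convex representations of a poset does not
decrease the number of summands whose support has `d` as a maximal element. -/
theorem card_maximal_le_of_injective [Finite ι] [Finite κ]
    (f : RepHom (Rep.dfsum fun i => convexRep K (S i) (hS i))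
      (Rep.dfsum fun j => convexRep K (T j) (hT j)))
    (hf : ∀ p, Function.Injective (f.app p)) (d : Q) :
    Nat.card {i : ι // d ∈ S i ∧ ∀ y ∈ S i, d ≤ y → y = d} ≤
      Nat.card {j : κ // d ∈ T j ∧ ∀ y ∈ T j, d ≤ y → y = d} := by
  set φ : ι → Prop := fun i => d ∈ S i ∧ ∀ y ∈ S i, d ≤ y → y = d with hφ
  set ψ : κ → Prop := fun j => d ∈ T j ∧ ∀ y ∈ T j, d ≤ y → y = d with hψ
  let fd : (∀ i, convexSub K (S i) d) →ₗ[K] ∀ j, convexSub K (T j) d := f.app d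
  let L := (fiberRestrict T d ψ).comp (fd.comp (fiberExtend S d φ fun i h => h.1))
  have hL : Function.Injective L := by
    refine (injective_iff_map_eq_zero L).2 fun x hx => ?_
    let e := fiberExtend S d φ (fun i h => h.1) x
    have hfe : fd e = 0 := by
      funext j
      apply Subtype.ext
      by_cases hj : ψ j
      · exact congrFun hx ⟨j, hj⟩
      by_cases hd : d ∈ T j
      · obtain ⟨y, hy, hdy, hne⟩ : ∃ y ∈ T j, d ≤ y ∧ y ≠ d := by
          simpa [hψ, hd] using hj
        have hker : (Rep.dfsum fun i => convexRep K (S i) (hS i)).map hdy e = 0 := by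
          funext i
          apply Subtype.ext
          refine (dfsum_map_coe S hS hdy e i).trans ?_
          by_cases hi : φ i
          · exact convexSub_coe_eq_zero (fun h => hne (hi.2 y h hdy)) _
          · have : e i = 0 := Subtype.ext (fiberExtend_coe_neg _ x hi)
            rw [this, map_zero]
            rfl
        have hnat := f.naturality_apply hdy e
        rw [hker, map_zero] at hnat
        have hco := dfsum_map_coe T hT hdy (fd e) j
        rw [phiMap_coe K hd hy] at hco
        rw [← hco]
        exact congrArg Subtype.val (congrFun hnat j)
      · exact convexSub_coe_eq_zero hd _
    have he : e = 0 := hf d (hfe.trans (map_zero (f.app d)).symm)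
    funext i
    rw [← fiberExtend_coe_pos (fun i h => h.1) x i.2]
    exact congrArg Subtype.val (congrFun he i.1)
  have := Fintype.ofFinite {i // φ i}
  have := Fintype.ofFinite {j // ψ j}
  simpa [Nat.card_eq_fintype_card] using LinearMap.finrank_le_finrank_of_injective hL

/-- An epimorphism between finite direct sums of convex representations of a poset does not
increase the number of summands whose support has `b` as a minimal element. -/
theorem card_minimal_le_of_surjective [Finite ι] [Finite κ]
    (g : RepHom (Rep.dfsum fun i => convexRep K (S i) (hS i))
      (Rep.dfsum fun j => convexRep K (T j) (hT j)))
    (hg : ∀ p, Function.Surjective (g.app p)) (b : Q) :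
    Nat.card {j : κ // b ∈ T j ∧ ∀ y ∈ T j, y ≤ b → y = b} ≤
      Nat.card {i : ι // b ∈ S i ∧ ∀ y ∈ S i, y ≤ b → y = b} := by
  classical
  have := Fintype.ofFinite ι
  set φ : ι → Prop := fun i => b ∈ S i ∧ ∀ y ∈ S i, y ≤ b → y = b with hφ
  set ψ : κ → Prop := fun j => b ∈ T j ∧ ∀ y ∈ T j, y ≤ b → y = b with hψ
  let gb : (∀ i, convexSub K (S i) b) →ₗ[K] ∀ j, convexSub K (T j) b := g.app b
  let R : (∀ i, convexSub K (S i) b) →ₗ[K] ({j // ψ j} → K) := (fiberRestrict T b ψ).comp gb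
  let E := fiberExtend (K := K) S b φ fun i h => h.1
  have hR : Function.Surjective R := by
    intro y
    obtain ⟨a, ha⟩ := hg b (fiberExtend T b ψ (fun j h => h.1) y)
    refine ⟨a, funext fun j => ?_⟩
    rw [← fiberExtend_coe_pos (fun j h => h.1) y j.2]
    exact congrArg Subtype.val (congrFun ha j.1)
  have hsingle : ∀ i, ¬φ i → ∀ c : convexSub K (S i) b, R (Pi.single i c) = 0 := by
    intro i hi c
    by_cases hb : b ∈ S i
    · obtain ⟨y, hy, hyb, hne⟩ : ∃ y ∈ S i, y ≤ b ∧ y ≠ b := by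
        simpa [hφ, hb] using hi
      let c' : convexSub K (S i) y := ⟨c, by simp [convexSub_pos K hy]⟩
      let v : ∀ i, convexSub K (S i) y := Pi.single i c'
      have hv : (Rep.dfsum fun i => convexRep K (S i) (hS i)).map hyb v =
          (Pi.single i c : ∀ i, convexSub K (S i) b) := by
        funext k
        apply Subtype.ext
        refine (dfsum_map_coe S hS hyb v k).trans ?_
        by_cases hk : k = i
        · subst hk
          rw [phiMap_coe K hy hb]
          simp [v, c']
        · simp [v, Pi.single_eq_of_ne hk]
      funext j
      have hnat := g.naturality_apply hyb v
      rw [hv] at hnat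
      have hyj : y ∉ T j.1 := fun h => hne (j.2.2 y h hyb)
      refine (congrArg Subtype.val (congrFun hnat j.1)).symm.trans ?_
      refine (dfsum_map_coe T hT hyb _ j.1).trans ?_
      rw [phiMap_neg K fun h => hyj h.1]
      rfl
    · have : c = 0 := Subtype.ext (convexSub_coe_eq_zero hb c)
      rw [this, Pi.single_zero, map_zero]
  have hL : Function.Surjective (R.comp E) := by
    intro y
    obtain ⟨a, rfl⟩ := hR y
    refine ⟨fun i => a i.1, ?_⟩
    have hdiff : R (E (fun i => a i.1) - a) = 0 := by
      rw [← Finset.univ_sum_single (E (fun i => a i.1) - a), map_sum]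
      refine Finset.sum_eq_zero fun i _ => ?_
      by_cases hi : φ i
      · have : (E (fun i => a i.1) - a) i = 0 := by
          rw [Pi.sub_apply, sub_eq_zero]
          exact Subtype.ext (fiberExtend_coe_pos _ _ hi)
        rw [this, Pi.single_zero, map_zero]
      · exact hsingle i hi _
    rwa [map_sub, sub_eq_zero] at hdiff
  have := Fintype.ofFinite {i // φ i}
  have := Fintype.ofFinite {j // ψ j}
  simpa [Nat.card_eq_fintype_card] using LinearMap.finrank_le_finrank_of_surjective hL

end Counting

/-- Let `P` be an asymmetric n-Vee and `A = ⊕ᵢ Aᵢ`, `C = ⊕ⱼ Cⱼ`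
finite direct sums of convex representations of `P`.  (i) If there is a morphism
`A → C` with all components injective, then for every `d ∈ P` the number of summands of
`A` whose support has `d` as a maximal element is at most the corresponding number for
`C`.  (ii) If there is a morphism `A → C` with all components surjective, then for
every `b ∈ P` the number of summands of `C` whose support has `b` as minimal element is
at most the corresponding number for `A`. -/
theorem statement17 {P : Type*} [PartialOrder P] [Finite P] (m : P)
    (hP : IsAsymNVee P m) {K : Type*} [Field K]
    {ι κ : Type*} [Finite ι] [Finite κ]
    (S : ι → Set P) (T : κ → Set P)
    (hSne : ∀ i, (S i).Nonempty) (hSconn : ∀ i, ConnectedIn (S i))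
    (hSconv : ∀ i, (S i).OrdConnected)
    (hTne : ∀ j, (T j).Nonempty) (hTconn : ∀ j, ConnectedIn (T j))
    (hTconv : ∀ j, (T j).OrdConnected) :
    ((∀ f : RepHom (Rep.dfsum fun i => convexRep K (S i) (hSconv i))
          (Rep.dfsum fun j => convexRep K (T j) (hTconv j)),
        (∀ p, Function.Injective (f.app p)) →
        ∀ d : P,
          Nat.card {i : ι // d ∈ S i ∧ ∀ y ∈ S i, d ≤ y → y = d} ≤
            Nat.card {j : κ // d ∈ T j ∧ ∀ y ∈ T j, d ≤ y → y = d}) ∧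
      (∀ g : RepHom (Rep.dfsum fun i => convexRep K (S i) (hSconv i))
          (Rep.dfsum fun j => convexRep K (T j) (hTconv j)),
        (∀ p, Function.Surjective (g.app p)) →
        ∀ b : P,
          Nat.card {j : κ // b ∈ T j ∧ ∀ y ∈ T j, y ≤ b → y = b} ≤
            Nat.card {i : ι // b ∈ S i ∧ ∀ y ∈ S i, y ≤ b → y = b})) := by
  exact ⟨fun f hf d => card_maximal_le_of_injective f hf d,
    fun g hg b => card_minimal_le_of_surjective g hg b⟩

end GPM
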